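/- Let 0 < α < 1, x > 0, and let y be six times continuously differentiable on [0,x]. Define the L1 weights σ₀ = 1, σ_k = (k+1)^{1−α} − 2k^{1−α} + (k−1)^{1−α} for 1 ≤ k ≤ N−1, σ_N = (N−1)^{1−α} − N^{1−α}. Then there exists a constant C > 0 such that for every integer N ≥ 2, with h = x/N, |(1/h^α) ∑_{k=0}^{N} σ_k y(x−kh) − ( h^{2−α} ∑_{k=1}^{N−1} k^{1−α} y″(x−kh) + (h^{4−α}/12) ∑_{k=1}^{N−1} k^{1−α} y⁽⁴⁾(x−kh) + x^{1−α} ( y′(h/2) + (h²/24) y‴(h/2) ) )| ≤ C h⁴. -/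

import Mathlib

/-- The L1 weights `σ_k` for the approximation of the Caputo derivative of
order `α` with `N` mesh points: `σ₀ = 1`,
`σ_k = (k+1)^{1-α} - 2k^{1-α} + (k-1)^{1-α}` for `1 ≤ k ≤ N-1`, and
`σ_N = (N-1)^{1-α} - N^{1-α}`. -/
noncomputable def L1weight (α : ℝ) (N k : ℕ) : ℝ :=
  if k = 0 then 1
  else if k = N then ((N : ℝ) - 1) ^ (1 - α) - (N : ℝ) ^ (1 - α)
  else ((k : ℝ) + 1) ^ (1 - α) - 2 * (k : ℝ) ^ (1 - α) + ((k : ℝ) - 1) ^ (1 - α)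

open scoped Nat in
/-- Two-sided Taylor expansion with uniform remainder bound. -/
lemma taylor_two_sided (x : ℝ) (hx : 0 < x) (y : ℝ → ℝ) (n : ℕ)
    (hy : ContDiffOn ℝ (n + 1) y (Set.Icc 0 x)) :
    ∃ M : ℝ, 0 ≤ M ∧ ∀ c ∈ Set.Ioo 0 x, ∀ t ∈ Set.Icc 0 x, c ≠ t →
      |y t - ∑ k ∈ Finset.range (n + 1), ((k ! : ℝ)⁻¹ * (t - c) ^ k) * iteratedDeriv k y c|
        ≤ M * |t - c| ^ (n + 1) := by
  have hu : UniqueDiffOn ℝ (Set.Icc 0 x) := uniqueDiffOn_Icc hx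
  have hcont := hy.continuousOn_iteratedDerivWithin (m := n + 1) (by norm_cast) hu
  obtain ⟨M, hM⟩ := isCompact_Icc.exists_bound_of_continuousOn hcont
  have hat : ∀ c ∈ Set.Ioo 0 x, ContDiffAt ℝ (n + 1) y c := fun c hc =>
    hy.contDiffAt (Icc_mem_nhds hc.1 hc.2)
  have hM0 : 0 ≤ M := (norm_nonneg _).trans (hM 0 ⟨le_rfl, hx.le⟩)
  refine ⟨M, hM0, fun c hc t ht hct => ?_⟩
  have hsub : Set.uIcc c t ⊆ Set.Icc 0 x :=
    Set.uIcc_subset_Icc ⟨hc.1.le, hc.2.le⟩ ht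
  obtain ⟨z, hz, he⟩ := taylor_mean_remainder_lagrange_iteratedDeriv hct (hy.mono hsub)
  have hz' : z ∈ Set.Ioo 0 x := by
    have h1 : min c t < z := hz.1
    have h2 : z < max c t := hz.2
    exact ⟨(le_min hc.1.le ht.1).trans_lt h1, h2.trans_le (max_le hc.2.le ht.2)⟩
  have hpoly : taylorWithinEval y n (Set.uIcc c t) c t =
      ∑ k ∈ Finset.range (n + 1), ((k ! : ℝ)⁻¹ * (t - c) ^ k) * iteratedDeriv k y c := by
    rw [taylor_within_apply]
    refine Finset.sum_congr rfl fun k hk => ?_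
    rw [smul_eq_mul, iteratedDerivWithin_eq_iteratedDeriv (uniqueDiffOn_uIcc hct) _
      Set.left_mem_uIcc]
    refine (hat c hc).of_le ?_
    have := Finset.mem_range.1 hk
    exact_mod_cast this.le
  rw [← hpoly, he]
  have hb : |iteratedDeriv (n + 1) y z| ≤ M := by
    have := hM z ⟨hz'.1.le, hz'.2.le⟩
    rwa [iteratedDerivWithin_eq_iteratedDeriv hu (by exact_mod_cast hat z hz')
      ⟨hz'.1.le, hz'.2.le⟩] at this
  rw [abs_div, abs_mul, abs_pow]
  have hf : (1 : ℝ) ≤ |((n + 1)! : ℝ)| := by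
    rw [Nat.abs_cast]
    exact_mod_cast Nat.succ_le_of_lt (Nat.factorial_pos _)
  refine (div_le_self (by positivity) hf).trans ?_
  gcongr

lemma sum_by_parts_second (a u : ℕ → ℝ) (h0 : a 0 = 0) (n : ℕ) :
    ∑ k ∈ Finset.range n, (a (k + 2) - 2 * a (k + 1) + a k) * u (k + 1) + a 1 * u 0
      + (a n - a (n + 1)) * u (n + 1)
    = ∑ k ∈ Finset.range n, a (k + 1) * (u k - 2 * u (k + 1) + u (k + 2))
      + a (n + 1) * (u n - u (n + 1)) := by
  induction n with
  | zero => simp [h0]; ring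
  | succ n ih =>
    rw [Finset.sum_range_succ, Finset.sum_range_succ]
    linear_combination ih

lemma sum_Icc_one_eq (f : ℕ → ℝ) (n : ℕ) :
    ∑ k ∈ Finset.Icc 1 n, f k = ∑ k ∈ Finset.range n, f (k + 1) := by
  induction n with
  | zero => simp
  | succ n ih => rw [Finset.sum_Icc_succ_top (by omega), ih, Finset.sum_range_succ]

lemma L1_sum_eq (α : ℝ) (hα1 : α < 1) (n : ℕ) (u : ℕ → ℝ) :
    ∑ k ∈ Finset.range (n + 1 + 1), L1weight α (n + 1) k * u k =
    ∑ k ∈ Finset.range n, ((k + 1 : ℕ) : ℝ) ^ (1 - α) * (u k - 2 * u (k + 1) + u (k + 2))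
      + ((n + 1 : ℕ) : ℝ) ^ (1 - α) * (u n - u (n + 1)) := by
  have key := sum_by_parts_second (fun k => (k : ℝ) ^ (1 - α)) u
    (by simp [Real.zero_rpow (by linarith : (1 - α) ≠ 0)]) n
  rw [← key, Finset.sum_range_succ, Finset.sum_range_succ']
  congr 1
  · congr 1
    · refine Finset.sum_congr rfl fun k hk => ?_
      have hk' := Finset.mem_range.1 hk
      have h1 : ¬ (k + 1 = n + 1) := by omega
      simp only [L1weight, h1, if_false, Nat.succ_ne_zero]
      push_cast
      rw [show (k : ℝ) + 1 + 1 = k + 2 by ring, show (k : ℝ) + 1 - 1 = k by ring]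
    · simp [L1weight]
  · simp [L1weight]

/-- Lemma 7 of the paper: fourth-order expansion of the (unnormalized) L1 sum
in terms of sums of second and fourth derivatives at the mesh points and
derivatives at the midpoint `h/2`. -/
theorem L1_fourth_order_representation (α x : ℝ) (hα0 : 0 < α) (hα1 : α < 1)
    (hx : 0 < x) (y : ℝ → ℝ) (hy : ContDiffOn ℝ 6 y (Set.Icc 0 x)) :
    ∃ C > 0, ∀ N : ℕ, 2 ≤ N → ∀ h : ℝ, h = x / N →
      |(1 / h ^ α) * (∑ k ∈ Finset.range (N + 1), L1weight α N k * y (x - k * h)) -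
        (h ^ (2 - α) * (∑ k ∈ Finset.Icc 1 (N - 1),
            (k : ℝ) ^ (1 - α) * iteratedDeriv 2 y (x - k * h)) +
          (h ^ (4 - α) / 12) * (∑ k ∈ Finset.Icc 1 (N - 1),
            (k : ℝ) ^ (1 - α) * iteratedDeriv 4 y (x - k * h)) +
          x ^ (1 - α) * (deriv y (h / 2) + (h ^ 2 / 24) * iteratedDeriv 3 y (h / 2)))|
        ≤ C * h ^ 4 := by
  obtain ⟨M, hM0, hM⟩ := taylor_two_sided x hx y 5 (by exact_mod_cast hy)
  obtain ⟨K, hK0, hK⟩ := taylor_two_sided x hx y 4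
    ((hy.of_le (by norm_num)))
  refine ⟨x ^ (2 - α) * (2 * M) + x ^ (1 - α) * K + 1, by positivity, ?_⟩
  intro N hN h hh
  obtain ⟨n, rfl⟩ : ∃ n, N = n + 1 := ⟨N - 1, by omega⟩
  have hn : 1 ≤ n := by omega
  have hNpos : (0 : ℝ) < ((n + 1 : ℕ) : ℝ) := by positivity
  have hpos : 0 < h := hh ▸ div_pos hx hNpos
  have hNh : ((n + 1 : ℕ) : ℝ) * h = x := by rw [hh]; field_simp
  have hNh' : ((n : ℝ) + 1) * h = x := by exact_mod_cast hNh
  rw [show n + 1 - 1 = n by omega, sum_Icc_one_eq, sum_Icc_one_eq,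
    L1_sum_eq α hα1 n (fun k => y (x - k * h))]
  -- second differences
  have hsecond : ∀ k ∈ Finset.range n,
      |(y (x - (k : ℕ) * h) - 2 * y (x - ((k + 1 : ℕ) : ℝ) * h) + y (x - ((k + 2 : ℕ) : ℝ) * h))
        - (h ^ 2 * iteratedDeriv 2 y (x - ((k + 1 : ℕ) : ℝ) * h)
          + h ^ 4 / 12 * iteratedDeriv 4 y (x - ((k + 1 : ℕ) : ℝ) * h))| ≤ 2 * M * h ^ 6 := by
    intro k hk
    have hk' : (k : ℝ) + 1 ≤ n := by exact_mod_cast Finset.mem_range.1 hk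
    have hk0 : (0 : ℝ) ≤ k := by positivity
    set c := x - ((k + 1 : ℕ) : ℝ) * h with hc
    have hce : c = ((n : ℝ) - k) * h := by rw [hc, ← hNh']; push_cast; ring
    have hc1 : h ≤ c := by rw [hce]; nlinarith
    have hc2 : c + h ≤ x := by rw [hc]; push_cast; nlinarith
    have e1 : x - (k : ℝ) * h = c + h := by rw [hc]; push_cast; ring
    have e2 : x - ((k + 2 : ℕ) : ℝ) * h = c - h := by rw [hc]; push_cast; ring
    rw [e1, e2]
    have t1 := hM c ⟨by linarith, by linarith⟩ (c + h) ⟨by linarith, by linarith⟩ (by linarith)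
    have t2 := hM c ⟨by linarith, by linarith⟩ (c - h) ⟨by linarith, by linarith⟩
      (by linarith)
    simp only [Finset.sum_range_succ, Finset.sum_range_zero, Nat.factorial] at t1 t2
    rw [add_sub_cancel_left, abs_of_pos hpos] at t1
    rw [show c - h - c = -h by ring, abs_neg, abs_of_pos hpos] at t2
    have t3 := (abs_add_le _ _).trans (add_le_add t1 t2)
    norm_num at t3
    refine le_trans (le_of_eq ?_) (t3.trans (le_of_eq (by ring)))
    congr 1
    ring
  -- endpoint
  have hend : |(y h - y 0) - h * (deriv y (h / 2) + h ^ 2 / 24 * iteratedDeriv 3 y (h / 2))|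
      ≤ K * h ^ 5 := by
    have hhx : h < x := by
      have : (1 : ℝ) ≤ n := by exact_mod_cast hn
      nlinarith
    have t1 := hK (h / 2) ⟨by linarith, by linarith⟩ h ⟨by linarith, by linarith⟩ (by linarith)
    have t2 := hK (h / 2) ⟨by linarith, by linarith⟩ 0 ⟨by linarith, by linarith⟩ (by linarith)
    simp only [Finset.sum_range_succ, Finset.sum_range_zero, Nat.factorial] at t1 t2
    rw [show h - h / 2 = h / 2 by ring, abs_of_pos (by positivity : 0 < h / 2)] at t1
    rw [show 0 - h / 2 = -(h / 2) by ring, abs_neg, abs_of_pos (by positivity : 0 < h / 2)] at t2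
    have t3 := (abs_sub _ _).trans (add_le_add t1 t2)
    norm_num at t3
    have : K * (h / 2) ^ 5 + K * (h / 2) ^ 5 ≤ K * h ^ 5 := by
      have : 0 ≤ K * h ^ 5 := by positivity
      have e : K * (h / 2) ^ 5 + K * (h / 2) ^ 5 = K * h ^ 5 / 16 := by ring
      linarith
    refine le_trans (le_of_eq ?_) (t3.trans this)
    congr 1
    ring
  have hn0 : x - (n : ℝ) * h = h := by rw [← hNh']; ring
  have hn1 : x - ((n + 1 : ℕ) : ℝ) * h = 0 := by rw [hNh]; ring
  simp only [hn0, hn1]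
  have p2 : h ^ (2 - α) = 1 / h ^ α * h ^ 2 := by
    rw [Real.rpow_sub hpos, Real.rpow_ofNat]; ring
  have p4 : h ^ (4 - α) = 1 / h ^ α * h ^ 4 := by
    rw [Real.rpow_sub hpos, Real.rpow_ofNat]; ring
  have p1 : h ^ (1 - α) = 1 / h ^ α * h := by
    rw [Real.rpow_sub hpos, Real.rpow_one]; ring
  have px : x ^ (1 - α) = ((n + 1 : ℕ) : ℝ) ^ (1 - α) * (1 / h ^ α * h) := by
    rw [← p1, ← Real.mul_rpow hNpos.le hpos.le, hNh]
  have px2 : x ^ (2 - α) = ((n + 1 : ℕ) : ℝ) ^ (1 - α) * ((n + 1 : ℕ) : ℝ) * (1 / h ^ α * h ^ 2) := by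
    rw [← p2, ← Real.rpow_add_one hNpos.ne', show 1 - α + 1 = 2 - α by ring,
      ← Real.mul_rpow hNpos.le hpos.le, hNh]
  have hQ : 0 < 1 / h ^ α := by positivity
  set Q := 1 / h ^ α with hQdef
  set A := ((n + 1 : ℕ) : ℝ) ^ (1 - α) with hA
  have hA0 : 0 ≤ A := by positivity
  set D : ℕ → ℝ := fun k =>
    (y (x - (k : ℕ) * h) - 2 * y (x - ((k + 1 : ℕ) : ℝ) * h) + y (x - ((k + 2 : ℕ) : ℝ) * h))
        - (h ^ 2 * iteratedDeriv 2 y (x - ((k + 1 : ℕ) : ℝ) * h)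
          + h ^ 4 / 12 * iteratedDeriv 4 y (x - ((k + 1 : ℕ) : ℝ) * h)) with hD
  have hsum : |∑ k ∈ Finset.range n, ((k + 1 : ℕ) : ℝ) ^ (1 - α) * D k|
      ≤ ((n + 1 : ℕ) : ℝ) * (A * (2 * M * h ^ 6)) := by
    refine (Finset.abs_sum_le_sum_abs _ _).trans ?_
    have : ∑ k ∈ Finset.range n, |((k + 1 : ℕ) : ℝ) ^ (1 - α) * D k|
        ≤ ∑ k ∈ Finset.range n, A * (2 * M * h ^ 6) := by
      refine Finset.sum_le_sum fun k hk => ?_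
      rw [abs_mul, abs_of_nonneg (by positivity : (0 : ℝ) ≤ ((k + 1 : ℕ) : ℝ) ^ (1 - α))]
      refine mul_le_mul ?_ (hsecond k hk) (abs_nonneg _) hA0
      refine Real.rpow_le_rpow (by positivity) ?_ (by linarith)
      have := Finset.mem_range.1 hk
      exact_mod_cast (by omega : k + 1 ≤ n + 1)
    refine this.trans ?_
    rw [Finset.sum_const, Finset.card_range, nsmul_eq_mul]
    refine mul_le_mul_of_nonneg_right ?_ (by positivity)
    push_cast; linarith
  have hsplit : ∑ k ∈ Finset.range n, ((k + 1 : ℕ) : ℝ) ^ (1 - α) * D k =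
      ∑ k ∈ Finset.range n, ((k + 1 : ℕ) : ℝ) ^ (1 - α) *
        (y (x - (k : ℕ) * h) - 2 * y (x - ((k + 1 : ℕ) : ℝ) * h) + y (x - ((k + 2 : ℕ) : ℝ) * h))
      - (h ^ 2 * ∑ k ∈ Finset.range n, ((k + 1 : ℕ) : ℝ) ^ (1 - α) *
          iteratedDeriv 2 y (x - ((k + 1 : ℕ) : ℝ) * h)
        + h ^ 4 / 12 * ∑ k ∈ Finset.range n, ((k + 1 : ℕ) : ℝ) ^ (1 - α) *
          iteratedDeriv 4 y (x - ((k + 1 : ℕ) : ℝ) * h)) := by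
    rw [Finset.mul_sum, Finset.mul_sum, ← Finset.sum_add_distrib, ← Finset.sum_sub_distrib]
    refine Finset.sum_congr rfl fun k _ => ?_
    simp only [hD]; ring
  set E := (y h - y 0) - h * (deriv y (h / 2) + h ^ 2 / 24 * iteratedDeriv 3 y (h / 2)) with hE
  have hfinal : |Q * (∑ k ∈ Finset.range n, ((k + 1 : ℕ) : ℝ) ^ (1 - α) * D k) + Q * A * E|
      ≤ (x ^ (2 - α) * (2 * M) + x ^ (1 - α) * K + 1) * h ^ 4 := by
    refine (abs_add_le _ _).trans ?_
    rw [abs_mul, abs_mul (Q * A), abs_of_pos hQ, abs_of_nonneg (by positivity : 0 ≤ Q * A)]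
    have b1 := mul_le_mul_of_nonneg_left hsum hQ.le
    have b2 := mul_le_mul_of_nonneg_left hend (by positivity : 0 ≤ Q * A)
    rw [px, px2]
    have : 0 ≤ h ^ 4 := by positivity
    nlinarith
  refine le_trans (le_of_eq ?_) hfinal
  rw [hsplit, p2, p4, px, hE]
  congr 1
  ring
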